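/- Let M = SM(U) be a loopless and coloopless Schubert matroid on [n] of rank r. For every i ≥ 0, the number of admissible Delannoy paths associated to SM(U) having exactly i diagonal steps equals the sum, over all bases B of M with e(B) = 1 and i(B) = 0, of the binomial coefficient C(α(B), i). -/

import Mathlib

open scoped Classical

namespace GPoly

/-- A step of a Delannoy path: east `+(1,0)`, north `+(0,1)` or diagonal `+(1,1)`. -/
inductive DStep : Type
  | east : DStep
  | north : DStep
  | diag : DStep
  deriving DecidableEq

/-- Horizontal displacement of a step. -/
def DStep.dx : DStep → ℕ
  | .east => 1
  | .north => 0
  | .diag => 1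

/-- Vertical displacement of a step. -/
def DStep.dy : DStep → ℕ
  | .east => 0
  | .north => 1
  | .diag => 1

/-- Position reached after the first `k` steps of `P`, starting at the point `s`. -/
def pathPos (s : ℕ × ℕ) (P : List DStep) (k : ℕ) : ℕ × ℕ :=
  (s.1 + ((P.take k).map DStep.dx).sum, s.2 + ((P.take k).map DStep.dy).sum)

/-- The Gale order: `U ≤ B` iff the increasing enumerations satisfy `u_ℓ ≤ b_ℓ`. -/
def galeLe {α : Type*} [LinearOrder α] (U B : Finset α) : Prop :=
  List.Forall₂ (· ≤ ·) (U.sort (· ≤ ·)) (B.sort (· ≤ ·))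

/-- Bases of the Schubert matroid `SM(U)` of rank `r` on `[n] = {1, …, n}`:
all `r`-subsets `B` of `[n]` with `U ≤ B` in the Gale order. -/
noncomputable def schubertBases (n r : ℕ) (U : Finset ℕ) : Finset (Finset ℕ) :=
  (Finset.Icc 1 n).powerset.filter fun B => B.card = r ∧ galeLe U B

/-- The point `p` lies weakly below the lattice path `path(U)`. -/
def belowPath (U : Finset ℕ) (p : ℕ × ℕ) : Prop :=
  p.2 ≤ (U ∩ Finset.Icc 1 (p.1 + p.2)).card

/-- `path(U)` traverses the vertical unit segment from `(x, y)` to `(x, y+1)`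
(by its north step number `x + y + 1`). -/
def uVertSeg (U : Finset ℕ) (x y : ℕ) : Prop :=
  x + y + 1 ∈ U ∧ (U ∩ Finset.Icc 1 (x + y + 1)).card = y + 1

/-- A Delannoy path associated to `SM(U)`: starts at `(1,1)`, ends at `(n-r, r)` and
stays weakly below `path(U)`. -/
def IsDelannoy (n r : ℕ) (U : Finset ℕ) (P : List DStep) : Prop :=
  pathPos (1, 1) P P.length = (n - r, r) ∧
    ∀ k ≤ P.length, belowPath U (pathPos (1, 1) P k)

/-- Admissible Delannoy path associated to `SM(U)`. -/
def IsAdmissible (n r : ℕ) (U : Finset ℕ) (P : List DStep) : Prop :=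
  IsDelannoy n r U P ∧
    ∀ (k : ℕ) (h : k < P.length),
      (P.get ⟨k, h⟩ = DStep.north →
        pathPos (1, 1) P (k + 1) = (n - r, r) ∨
          ¬ uVertSeg U (pathPos (1, 1) P k).1 (pathPos (1, 1) P k).2) ∧
      (P.get ⟨k, h⟩ = DStep.diag →
        belowPath U ((pathPos (1, 1) P k).1, (pathPos (1, 1) P k).2 + 1) ∧
          ¬ uVertSeg U (pathPos (1, 1) P k).1 (pathPos (1, 1) P k).2)

/-- Number of diagonal steps of a path. -/
def diagCount (P : List DStep) : ℕ := (P.filter (· = DStep.diag)).length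

/-- The set of indices (0-based) of the diagonal steps of `P`. -/
def diagIndices (P : List DStep) : Finset ℕ :=
  (Finset.range P.length).filter fun k => P.getD k DStep.east = DStep.diag

/-- Replace a diagonal step by a north step followed by an east step. -/
def expandNE : DStep → List DStep
  | DStep.diag => [DStep.north, DStep.east]
  | s => [s]

/-- Replace a diagonal step by an east step followed by a north step. -/
def expandEN : DStep → List DStep
  | DStep.diag => [DStep.east, DStep.north]
  | s => [s]

/-- The full lattice path of `B_P`: an east step, a north step, then the steps of `P`
with each diagonal step replaced by a north step immediately followed by an east step. -/
def fullPath (P : List DStep) : List DStep :=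
  DStep.east :: DStep.north :: (P.map expandNE).flatten

/-- The subset of `[n]` whose `path` is the given (diagonal-free) list of steps:
the set of (1-based) positions of the north steps. -/
def northSet (L : List DStep) : Finset ℕ :=
  ((Finset.range L.length).filter fun k => L.getD k DStep.east = DStep.north).image (· + 1)

/-- The basis `B_P` associated to a Delannoy path `P`. -/
def delannoyBasis (P : List DStep) : Finset ℕ := northSet (fullPath P)

/-! ### Matroid notions for a family of bases -/

/-- `S` is independent for the basis family `ℬ`: it is contained in some basis. -/
def famIndep (ℬ : Finset (Finset ℕ)) (S : Finset ℕ) : Prop := ∃ B ∈ ℬ, S ⊆ B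

/-- `C` is a circuit for the basis family `ℬ`: a minimal dependent set. -/
def famCircuit (ℬ : Finset (Finset ℕ)) (C : Finset ℕ) : Prop :=
  ¬ famIndep ℬ C ∧ ∀ C' ⊂ C, famIndep ℬ C'

/-- The dual basis family on the ground set `E`: complements of bases. -/
noncomputable def famDual (E : Finset ℕ) (ℬ : Finset (Finset ℕ)) : Finset (Finset ℕ) :=
  ℬ.image fun B => E \ B

/-- `e ∉ B` is externally active: `e` is the smallest element of the unique circuit
contained in `B ∪ {e}`. -/
def ExtActive (E : Finset ℕ) (ℬ : Finset (Finset ℕ)) (B : Finset ℕ) (e : ℕ) : Prop :=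
  e ∈ E ∧ e ∉ B ∧
    ∃ C, C ⊆ insert e B ∧ famCircuit ℬ C ∧ e ∈ C ∧ ∀ x ∈ C, e ≤ x

/-- `i ∈ B` is internally active: `i` is the smallest element of the unique cocircuit
contained in `(E ∖ B) ∪ {i}`. -/
def IntActive (E : Finset ℕ) (ℬ : Finset (Finset ℕ)) (B : Finset ℕ) (i : ℕ) : Prop :=
  i ∈ B ∧
    ∃ C, C ⊆ insert i (E \ B) ∧ famCircuit (famDual E ℬ) C ∧ i ∈ C ∧ ∀ x ∈ C, i ≤ x

/-- External activity `e(B)`. -/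
noncomputable def extAct (E : Finset ℕ) (ℬ : Finset (Finset ℕ)) (B : Finset ℕ) : ℕ :=
  (E.filter (ExtActive E ℬ B)).card

/-- Internal activity `i(B)`. -/
noncomputable def intAct (E : Finset ℕ) (ℬ : Finset (Finset ℕ)) (B : Finset ℕ) : ℕ :=
  (E.filter (IntActive E ℬ B)).card

/-- The statistic `α(B)`: the number of `i ∈ B` such that `B' = (B ∖ {i}) ∪ {i+1}`
is a basis with `e(B') = e(B)` and `i(B') = i(B)`. -/
noncomputable def alphaStat (E : Finset ℕ) (ℬ : Finset (Finset ℕ)) (B : Finset ℕ) : ℕ :=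
  (B.filter fun i =>
    insert (i + 1) (B.erase i) ∈ ℬ ∧
      extAct E ℬ (insert (i + 1) (B.erase i)) = extAct E ℬ B ∧
      intAct E ℬ (insert (i + 1) (B.erase i)) = intAct E ℬ B).card

/-- The rank function determined by a family of bases. -/
noncomputable def famRank (ℬ : Finset (Finset ℕ)) (A : Finset ℕ) : ℕ :=
  ℬ.sup fun B => (A ∩ B).card

/-- The β-invariant: `β(M) = (−1)^{rk(E)} Σ_{A ⊆ E} (−1)^{|A|} rk(A)`. -/
noncomputable def betaInv (E : Finset ℕ) (ℬ : Finset (Finset ℕ)) : ℤ :=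
  (-1) ^ famRank ℬ E * ∑ A ∈ E.powerset, (-1) ^ A.card * (famRank ℬ A : ℤ)

/-- `ℬ` is the collection of bases of a matroid with ground set `E`:
it is a nonempty family of subsets of `E` satisfying the basis exchange property. -/
def IsBasisFamily (E : Finset ℕ) (ℬ : Finset (Finset ℕ)) : Prop :=
  ℬ.Nonempty ∧ (∀ B ∈ ℬ, B ⊆ E) ∧
    ∀ B₁ ∈ ℬ, ∀ B₂ ∈ ℬ, ∀ x ∈ B₁ \ B₂, ∃ y ∈ B₂ \ B₁, insert y (B₁.erase x) ∈ ℬ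

/-- Two elements lie in a common component: they are equal or in a common circuit. -/
def connRel (ℬ : Finset (Finset ℕ)) (e f : ℕ) : Prop :=
  e = f ∨ ∃ C, famCircuit ℬ C ∧ e ∈ C ∧ f ∈ C

/-- The number of connected components of the matroid with bases `ℬ` on `E`. -/
noncomputable def numComponents (E : Finset ℕ) (ℬ : Finset (Finset ℕ)) : ℕ :=
  Set.ncard {S : Set ℕ | ∃ e ∈ E, S = {f | f ∈ E ∧ Relation.EqvGen (connRel ℬ) e f}}

/-- The matroid with bases `ℬ` on ground set `E` is connected. -/
def IsConnectedFam (E : Finset ℕ) (ℬ : Finset (Finset ℕ)) : Prop :=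
  E.Nonempty ∧ ∀ e ∈ E, ∀ f ∈ E, Relation.EqvGen (connRel ℬ) e f

/-- Series-parallel matroid: isomorphic to `U_{0,1}` or `U_{1,1}`
(a single loop or a single coloop), or connected with β-invariant `1`. -/
def IsSeriesParallel (E : Finset ℕ) (ℬ : Finset (Finset ℕ)) : Prop :=
  (E.card = 1 ∧ (ℬ = {∅} ∨ ℬ = {E})) ∨ (IsConnectedFam E ℬ ∧ betaInv E ℬ = 1)

/-- The bases of the restriction of the matroid with bases `ℬ` to the set `F`:
the maximal intersections of bases with `F`. -/
noncomputable def famRestrict (ℬ : Finset (Finset ℕ)) (F : Finset ℕ) : Finset (Finset ℕ) :=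
  (ℬ.image (· ∩ F)).filter fun S => ∀ T ∈ ℬ.image (· ∩ F), S ⊆ T → S = T

/-- The matroid with bases `ℬ` on `E` is a direct sum of series-parallel matroids. -/
def IsDirectSumOfSeriesParallel (E : Finset ℕ) (ℬ : Finset (Finset ℕ)) : Prop :=
  ∃ parts : Finset (Finset ℕ),
    (↑parts : Set (Finset ℕ)).PairwiseDisjoint id ∧
    parts.sup id = E ∧
    (∀ S ∈ parts, IsSeriesParallel S (famRestrict ℬ S)) ∧
    ℬ = E.powerset.filter fun B => ∀ S ∈ parts, B ∩ S ∈ famRestrict ℬ S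

/-! ### Base polytopes -/

/-- The indicator vector of `B ⊆ E`, as a point of `ℝ^E`. -/
noncomputable def basisVector (E : Finset ℕ) (B : Finset ℕ) : ↑E → ℝ :=
  fun e => if (e : ℕ) ∈ B then 1 else 0

/-- The base polytope of the matroid with bases `ℬ` on `E`:
the convex hull in `ℝ^E` of the indicator vectors of the bases. -/
noncomputable def basePolytope (E : Finset ℕ) (ℬ : Finset (Finset ℕ)) : Set (↑E → ℝ) :=
  convexHull ℝ (basisVector E '' (↑ℬ : Set (Finset ℕ)))

/-- The indicator function `ℝ^E → ℤ` of the base polytope. -/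
noncomputable def polyInd (E : Finset ℕ) (ℬ : Finset (Finset ℕ)) : (↑E → ℝ) → ℤ :=
  fun x => if x ∈ basePolytope E ℬ then 1 else 0

/-- The indicator function `ℝ^E → ℤ` of the relative interior of the base polytope. -/
noncomputable def relintInd (E : Finset ℕ) (ℬ : Finset (Finset ℕ)) : (↑E → ℝ) → ℤ :=
  fun x => if x ∈ intrinsicInterior ℝ (basePolytope E ℬ) then 1 else 0

/-! ### Cyclic flats and the cyclic chain lattice -/

/-- `F` is a flat of the matroid with bases `ℬ` on `E`. -/
def IsFlat (E : Finset ℕ) (ℬ : Finset (Finset ℕ)) (F : Finset ℕ) : Prop :=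
  F ⊆ E ∧ ∀ e ∈ E, famRank ℬ (insert e F) = famRank ℬ F → e ∈ F

/-- `F` is a cyclic flat: a flat whose restriction has no coloops. -/
def IsCyclicFlat (E : Finset ℕ) (ℬ : Finset (Finset ℕ)) (F : Finset ℕ) : Prop :=
  IsFlat E ℬ F ∧ ∀ e ∈ F, ¬ (∀ S ∈ famRestrict ℬ F, e ∈ S)

/-- The set of cyclic flats. -/
noncomputable def cyclicFlats (E : Finset ℕ) (ℬ : Finset (Finset ℕ)) : Finset (Finset ℕ) :=
  E.powerset.filter (IsCyclicFlat E ℬ)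

/-- A chain of cyclic flats containing the minimum and maximum of the lattice of
cyclic flats; these are the elements (other than the top `1̂`) of the cyclic
chain lattice. -/
def IsCyclicChain (E : Finset ℕ) (ℬ : Finset (Finset ℕ)) (C : Finset (Finset ℕ)) : Prop :=
  ↑C ⊆ (cyclicFlats E ℬ : Set (Finset ℕ)) ∧ IsChain (· ⊆ ·) (↑C : Set (Finset ℕ)) ∧
    (∃ F ∈ C, ∀ G ∈ cyclicFlats E ℬ, F ⊆ G) ∧
    (∃ F ∈ C, ∀ G ∈ cyclicFlats E ℬ, G ⊆ F)

/-- The set of chains of cyclic flats containing the minimum and the maximum. -/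
noncomputable def cyclicChains (E : Finset ℕ) (ℬ : Finset (Finset ℕ)) :
    Finset (Finset (Finset ℕ)) :=
  (cyclicFlats E ℬ).powerset.filter (IsCyclicChain E ℬ)

/-- The rank function `A ↦ min_{Z ∈ C} (rk_M(Z) + |A ∖ Z|)` associated to a chain `C`. -/
noncomputable def chainRank (ℬ : Finset (Finset ℕ)) (C : Finset (Finset ℕ))
    (A : Finset ℕ) : ℕ :=
  if h : C.Nonempty then C.inf' h fun Z => famRank ℬ Z + (A \ Z).card else A.card

/-- The bases of the matroid on `E` with rank function `rk`:
the subsets `B ⊆ E` with `rk B = |B| = rk E`. -/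
noncomputable def basesOfRank (E : Finset ℕ) (rk : Finset ℕ → ℕ) : Finset (Finset ℕ) :=
  E.powerset.filter fun B => rk B = B.card ∧ rk B = rk E

/-- The bases of the Schubert matroid `S_C` associated to a chain `C` of cyclic flats. -/
noncomputable def chainSchubert (E : Finset ℕ) (ℬ : Finset (Finset ℕ))
    (C : Finset (Finset ℕ)) : Finset (Finset ℕ) :=
  basesOfRank E (chainRank ℬ C)

/-- The point reached by `path(S)` after `k` steps. -/
def pathPoint (S : Finset ℕ) (k : ℕ) : ℕ × ℕ :=
  (k - (S ∩ Finset.Icc 1 k).card, (S ∩ Finset.Icc 1 k).card)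


/-! ### Helper lemmas -/

/-- Number of elements of `S` in `{1, …, k}`. -/
def cnt (S : Finset ℕ) (k : ℕ) : ℕ := (S ∩ Finset.Icc 1 k).card

lemma cnt_zero (S : Finset ℕ) : cnt S 0 = 0 := by simp [cnt]

lemma cnt_succ (S : Finset ℕ) (k : ℕ) :
    cnt S (k + 1) = cnt S k + if k + 1 ∈ S then 1 else 0 := by
  unfold cnt
  have h : Finset.Icc 1 (k + 1) = insert (k + 1) (Finset.Icc 1 k) := by
    ext x; simp; omega
  rw [h]
  split_ifs with hk
  · rw [Finset.inter_insert_of_mem hk, Finset.card_insert_of_notMem (by simp)]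
  · rw [Finset.inter_insert_of_notMem hk]; rfl

lemma cnt_mono (S : Finset ℕ) : Monotone (cnt S) := by
  intro a b h
  unfold cnt
  apply Finset.card_le_card
  intro x hx
  simp at hx ⊢
  exact ⟨hx.1, hx.2.1, by omega⟩

lemma cnt_full {S : Finset ℕ} {n k : ℕ} (h : S ⊆ Finset.Icc 1 n) (hk : n ≤ k) :
    cnt S k = S.card := by
  unfold cnt
  rw [Finset.inter_eq_left.2]
  exact h.trans (Finset.Icc_subset_Icc le_rfl hk)

/-! #### Gale order through counting -/

lemma forall₂_count {l₁ l₂ : List ℕ} (h : List.Forall₂ (· ≤ ·) l₁ l₂) (k : ℕ) :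
    l₂.countP (· ≤ k) ≤ l₁.countP (· ≤ k) := by
  induction h with
  | nil => simp
  | cons hab _ ih =>
    simp only [List.countP_cons, decide_eq_true_eq]
    split_ifs <;> omega

lemma count_forall₂ : ∀ (l₁ l₂ : List ℕ), l₁.length = l₂.length →
    l₁.Pairwise (· ≤ ·) → l₂.Pairwise (· ≤ ·) →
    (∀ k, l₂.countP (· ≤ k) ≤ l₁.countP (· ≤ k)) → List.Forall₂ (· ≤ ·) l₁ l₂
  | [], [], _, _, _, _ => List.Forall₂.nil
  | [], _ :: _, h, _, _, _ => by simp at h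
  | _ :: _, [], h, _, _, _ => by simp at h
  | u :: us, b :: bs, hlen, hs1, hs2, hc => by
    rw [List.pairwise_cons] at hs1 hs2
    have hub : u ≤ b := by
      have h1 := hc b
      have h2 : 0 < (u :: us).countP (· ≤ b) := by
        refine lt_of_lt_of_le ?_ h1
        simp [List.countP_cons]
      rw [List.countP_pos_iff] at h2
      obtain ⟨a, ha, hab⟩ := h2
      simp only [decide_eq_true_eq] at hab
      rcases List.mem_cons.1 ha with rfl | ha
      · exact hab
      · exact (hs1.1 a ha).trans hab
    refine List.Forall₂.cons hub
      (count_forall₂ us bs (by simpa using hlen) hs1.2 hs2.2 fun k => ?_)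
    by_cases hk : b ≤ k
    · have := hc k
      simp only [List.countP_cons, decide_eq_true_eq, hk, hub.trans hk, if_true] at this
      omega
    · have : bs.countP (· ≤ k) = 0 := by
        rw [List.countP_eq_zero]
        intro a ha
        have := hs2.1 a ha
        simp; omega
      omega

lemma countP_sort {n : ℕ} {S : Finset ℕ} (hS : S ⊆ Finset.Icc 1 n) (k : ℕ) :
    (S.sort (· ≤ ·)).countP (· ≤ k) = cnt S k := by
  rw [List.countP_eq_length_filter, cnt]
  have h1 : ((S.sort (· ≤ ·)).filter (fun x => decide (x ≤ k))).Nodup :=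
    (Finset.sort_nodup S (· ≤ ·)).filter _
  rw [← List.toFinset_card_of_nodup h1]
  congr 1
  ext x
  simp only [List.mem_toFinset, List.mem_filter, Finset.mem_sort, decide_eq_true_eq,
    Finset.mem_inter, Finset.mem_Icc]
  constructor
  · rintro ⟨h, h'⟩
    exact ⟨h, (Finset.mem_Icc.1 (hS h)).1, h'⟩
  · rintro ⟨h, _, h'⟩
    exact ⟨h, h'⟩

lemma mem_bases {n r : ℕ} {U : Finset ℕ} (hU : U ⊆ Finset.Icc 1 n) (hr : U.card = r)
    (B : Finset ℕ) : B ∈ schubertBases n r U ↔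
      B ⊆ Finset.Icc 1 n ∧ B.card = r ∧ ∀ k, cnt B k ≤ cnt U k := by
  unfold schubertBases
  rw [Finset.mem_filter, Finset.mem_powerset]
  unfold galeLe
  constructor
  · rintro ⟨h1, h2, h3⟩
    refine ⟨h1, h2, fun k => ?_⟩
    rw [← countP_sort h1, ← countP_sort hU]
    exact forall₂_count h3 k
  · rintro ⟨h1, h2, h3⟩
    refine ⟨h1, h2, count_forall₂ _ _ (by simp [h2, hr]) (Finset.pairwise_sort _ _)
      (Finset.pairwise_sort _ _) fun k => ?_⟩
    rw [countP_sort h1, countP_sort hU]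
    exact h3 k

/-! #### Exchanges -/

/-- Exchanging `x ∈ B` for `y ∉ B`. -/
lemma exch_card {B : Finset ℕ} {x y : ℕ} (hx : x ∈ B) (hy : y ∉ B) :
    (insert y (B.erase x)).card = B.card := by
  rw [Finset.card_insert_of_notMem (by simp [hy]), Finset.card_erase_add_one hx]

lemma exch_cnt {B : Finset ℕ} {x y : ℕ} (hx : x ∈ B) (hy : y ∉ B) (hx1 : 1 ≤ x)
    (hy1 : 1 ≤ y) (k : ℕ) :
    cnt (insert y (B.erase x)) k + (if x ≤ k then 1 else 0)
      = cnt B k + (if y ≤ k then 1 else 0) := by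
  have hxy : x ≠ y := by rintro rfl; exact hy hx
  induction k with
  | zero => rw [cnt_zero, cnt_zero, if_neg (by omega), if_neg (by omega)]
  | succ k ih =>
    rw [cnt_succ, cnt_succ]
    have e1 : (k + 1 ∈ insert y (B.erase x)) ↔ (k + 1 = y ∨ (k + 1 ≠ x ∧ k + 1 ∈ B)) := by
      simp
    by_cases h1 : k + 1 = y
    · subst h1
      rw [if_pos (e1.2 (Or.inl rfl)), if_neg hy]
      split_ifs at ih ⊢ <;> omega
    · by_cases h2 : k + 1 = x
      · subst h2
        rw [if_neg (by rw [e1]; simp [h1]), if_pos hx]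
        split_ifs at ih ⊢ <;> omega
      · have e2 : (k + 1 ∈ insert y (B.erase x)) ↔ k + 1 ∈ B := by rw [e1]; simp [h1, h2]
        simp only [e2]
        split_ifs at ih ⊢ <;> omega

/-- Every dependent set contains a circuit. -/
lemma exists_circuit (ℬ : Finset (Finset ℕ)) (S : Finset ℕ) (h : ¬ famIndep ℬ S) :
    ∃ C ⊆ S, famCircuit ℬ C := by
  induction S using Finset.strongInduction with
  | H S ih =>
    by_cases hc : ∀ C' ⊂ S, famIndep ℬ C'
    · exact ⟨S, subset_rfl, h, hc⟩
    · push Not at hc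
      obtain ⟨C', hC', hd⟩ := hc
      obtain ⟨C, hC, hcirc⟩ := ih C' hC' hd
      exact ⟨C, hC.trans hC'.1, hcirc⟩

section activity

variable {n r : ℕ} {U : Finset ℕ}

lemma extActive_iff (hU : U ⊆ Finset.Icc 1 n) (hr : U.card = r) {B : Finset ℕ}
    (hB : B ∈ schubertBases n r U) (e : ℕ) :
    ExtActive (Finset.Icc 1 n) (schubertBases n r U) B e ↔
      e ∈ Finset.Icc 1 n ∧ e ∉ B ∧ ∀ f ∈ B, e < f := by
  have hB' := (mem_bases hU hr B).1 hB
  constructor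
  · rintro ⟨he, heB, C, hC, hcirc, heC, hmin⟩
    refine ⟨he, heB, fun f hf => ?_⟩
    by_contra hlt
    have hne : f ≠ e := by rintro rfl; exact heB hf
    have hfe : f < e := by omega
    have hf1 : 1 ≤ f := (Finset.mem_Icc.1 (hB'.1 hf)).1
    have he1 : 1 ≤ e := (Finset.mem_Icc.1 he).1
    refine hcirc.1 ⟨insert e (B.erase f), ?_, ?_⟩
    · rw [mem_bases hU hr]
      refine ⟨?_, ?_, fun k => ?_⟩
      · exact Finset.insert_subset he ((Finset.erase_subset _ _).trans hB'.1)
      · rw [exch_card hf heB]; exact hB'.2.1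
      · have h1 := exch_cnt hf heB hf1 he1 k
        have h2 := hB'.2.2 k
        split_ifs at h1 <;> omega
    · intro x hx
      have h1 := hC hx
      have h2 := hmin x hx
      rw [Finset.mem_insert] at h1 ⊢
      rcases h1 with h1 | h1
      · exact Or.inl h1
      · exact Or.inr (Finset.mem_erase.2 ⟨by omega, h1⟩)
  · rintro ⟨he, heB, hlt⟩
    have hdep : ¬ famIndep (schubertBases n r U) (insert e B) := by
      rintro ⟨B₁, hB₁, hsub⟩
      have h1 := Finset.card_le_card hsub
      rw [Finset.card_insert_of_notMem heB, ((mem_bases hU hr B₁).1 hB₁).2.1, hB'.2.1] at h1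
      omega
    obtain ⟨C, hC, hcirc⟩ := exists_circuit _ _ hdep
    refine ⟨he, heB, C, hC, hcirc, ?_, ?_⟩
    · by_contra heC
      refine hcirc.1 ⟨B, hB, fun x hx => ?_⟩
      rcases Finset.mem_insert.1 (hC hx) with rfl | h
      · exact absurd hx heC
      · exact h
    · intro x hx
      rcases Finset.mem_insert.1 (hC hx) with rfl | h
      · exact le_rfl
      · exact (hlt x h).le

lemma extAct_eq_one (hU : U ⊆ Finset.Icc 1 n) (hr : U.card = r) (hn : 2 ≤ n) (hr1 : 1 ≤ r)
    {B : Finset ℕ} (hB : B ∈ schubertBases n r U) :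
    extAct (Finset.Icc 1 n) (schubertBases n r U) B = 1 ↔ 1 ∉ B ∧ 2 ∈ B := by
  have hB' := (mem_bases hU hr B).1 hB
  unfold extAct
  constructor
  · intro h
    obtain ⟨e, he⟩ := Finset.card_eq_one.1 h
    have key : ∀ x, x ∈ (Finset.Icc 1 n).filter
        (ExtActive (Finset.Icc 1 n) (schubertBases n r U) B) ↔ x = e := by
      intro x; rw [he]; simp
    simp only [Finset.mem_filter, extActive_iff hU hr hB, Finset.mem_Icc] at key
    obtain ⟨he1, _, he2, he3⟩ := (key e).2 rfl
    have hall : ∀ x, 1 ≤ x → x ≤ e → x = e := by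
      intro x hx1 hx2
      refine (key x).1 ⟨⟨hx1, by omega⟩, ⟨hx1, by omega⟩, fun hx => ?_, fun f hf => ?_⟩
      · have := he3 x hx; omega
      · have := he3 f hf; omega
    have h1e := hall 1 le_rfl he1.1
    subst h1e
    refine ⟨he2, ?_⟩
    by_contra h2
    have := (key 2).1 ⟨⟨by omega, hn⟩, ⟨by omega, hn⟩, h2, fun f hf => ?_⟩
    · omega
    · have h4 := he3 f hf
      have : f ≠ 2 := by rintro rfl; exact h2 hf
      omega
  · rintro ⟨h1, h2⟩
    rw [Finset.card_eq_one]
    refine ⟨1, ?_⟩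
    ext x
    simp only [Finset.mem_filter, extActive_iff hU hr hB, Finset.mem_Icc, Finset.mem_singleton]
    constructor
    · rintro ⟨hx, _, _, hx3⟩
      have := hx3 2 h2
      omega
    · rintro rfl
      refine ⟨⟨le_rfl, by omega⟩, ⟨le_rfl, by omega⟩, h1, fun f hf => ?_⟩
      have h3 := (Finset.mem_Icc.1 (hB'.1 hf)).1
      have : f ≠ 1 := by rintro rfl; exact h1 hf
      omega

lemma intAct_eq_zero (hU : U ⊆ Finset.Icc 1 n) (hr : U.card = r)
    {B : Finset ℕ} (hB : B ∈ schubertBases n r U) (h1B : 1 ∉ B) :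
    intAct (Finset.Icc 1 n) (schubertBases n r U) B = 0 ↔
      ∀ k ∈ B, cnt B (k - 1) < cnt U (k - 1) := by
  have hB' := (mem_bases hU hr B).1 hB
  unfold intAct
  rw [Finset.card_eq_zero, Finset.filter_eq_empty_iff]
  constructor
  · intro h k hk
    by_contra hlt
    have hkI := Finset.mem_Icc.1 (hB'.1 hk)
    refine h (hB'.1 hk) ⟨hk, ?_⟩
    set D : Finset ℕ := insert k ((Finset.Icc 1 n \ B).filter (k < ·)) with hD
    have hdep : ¬ famIndep (famDual (Finset.Icc 1 n) (schubertBases n r U)) D := by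
      rintro ⟨_, hS, hsub⟩
      unfold famDual at hS
      rw [Finset.mem_image] at hS
      obtain ⟨B₁, hB₁, rfl⟩ := hS
      have hB₁' := (mem_bases hU hr B₁).1 hB₁
      have hs : B₁ ⊆ (B₁ ∩ Finset.Icc 1 (k - 1)) ∪ (B.filter (k < ·)) := by
        intro x hx
        have hxI := Finset.mem_Icc.1 (hB₁'.1 hx)
        rw [Finset.mem_union, Finset.mem_inter, Finset.mem_Icc, Finset.mem_filter]
        rcases lt_trichotomy x k with hxk | hxk | hxk
        · exact Or.inl ⟨hx, hxI.1, by omega⟩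
        · subst hxk
          have := hsub (Finset.mem_insert_self _ _)
          simp [hx] at this
        · right
          refine ⟨?_, hxk⟩
          by_contra hxB
          have : x ∈ D := by
            rw [hD, Finset.mem_insert, Finset.mem_filter, Finset.mem_sdiff]
            exact Or.inr ⟨⟨hB₁'.1 hx, hxB⟩, hxk⟩
          have := hsub this
          simp [hx] at this
      have h2 := (Finset.card_le_card hs).trans (Finset.card_union_le _ _)
      have h3 : (B ∩ Finset.Icc 1 (k - 1)).card + (B.filter (k < ·)).card + 1 ≤ B.card := by
        rw [← Finset.card_union_of_disjoint, ← Finset.card_insert_of_notMem (a := k)]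
        · apply Finset.card_le_card
          intro x hx
          simp only [Finset.mem_insert, Finset.mem_union, Finset.mem_inter,
            Finset.mem_filter] at hx
          rcases hx with rfl | hx | hx
          · exact hk
          · exact hx.1
          · exact hx.1
        · simp; omega
        · rw [Finset.disjoint_left]
          intro x hx hx'
          simp at hx hx'
          omega
      have h4 := hB₁'.2.2 (k - 1)
      rw [hB₁'.2.1] at h2
      rw [hB'.2.1] at h3
      unfold cnt at hlt h4
      omega
    obtain ⟨C, hC, hcirc⟩ := exists_circuit _ _ hdep
    refine ⟨C, ?_, hcirc, ?_, ?_⟩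
    · refine hC.trans (Finset.insert_subset_insert _ (Finset.filter_subset _ _))
    · by_contra hkC
      refine hcirc.1 ⟨Finset.Icc 1 n \ B, Finset.mem_image.2 ⟨B, hB, rfl⟩, fun x hx => ?_⟩
      rcases Finset.mem_insert.1 (hC hx) with rfl | h
      · exact absurd hx hkC
      · exact (Finset.mem_filter.1 h).1
    · intro x hx
      rcases Finset.mem_insert.1 (hC hx) with rfl | h
      · exact le_rfl
      · exact (Finset.mem_filter.1 h).2.le
  · rintro h i - ⟨hi, C, hC, hcirc, hiC, hmin⟩
    have hiI := Finset.mem_Icc.1 (hB'.1 hi)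
    have hi1 : i ≠ 1 := by rintro rfl; exact h1B hi
    set G := (Finset.Icc 1 (i - 1)).filter (· ∉ B) with hG
    have hGne : G.Nonempty := ⟨1, by rw [hG, Finset.mem_filter, Finset.mem_Icc]; exact ⟨by omega, h1B⟩⟩
    obtain ⟨e, he, hemax⟩ : ∃ e ∈ G, ∀ x ∈ G, x ≤ e :=
      ⟨G.max' hGne, G.max'_mem hGne, fun x hx => G.le_max' x hx⟩
    rw [hG, Finset.mem_filter, Finset.mem_Icc] at he
    obtain ⟨⟨he1, hei⟩, heB⟩ := he
    refine hcirc.1 ⟨Finset.Icc 1 n \ insert e (B.erase i),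
      Finset.mem_image.2 ⟨insert e (B.erase i), ?_, rfl⟩, ?_⟩
    · rw [mem_bases hU hr]
      refine ⟨?_, ?_, fun k => ?_⟩
      · exact Finset.insert_subset (Finset.mem_Icc.2 ⟨he1, by omega⟩)
          ((Finset.erase_subset _ _).trans hB'.1)
      · rw [exch_card hi heB]; exact hB'.2.1
      · have h1 := exch_cnt hi heB hiI.1 he1 k
        have h2 := hB'.2.2 k
        by_cases hk : e ≤ k ∧ k < i
        · have hkB : k + 1 ∈ B := by
            by_contra hkB
            by_cases hki : k + 1 = i
            · rw [hki] at hkB; exact hkB hi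
            · have := hemax (k + 1) (by
                rw [hG, Finset.mem_filter, Finset.mem_Icc]; exact ⟨by omega, hkB⟩)
              omega
          have := h (k + 1) hkB
          simp only [Nat.add_sub_cancel] at this
          split_ifs at h1 <;> omega
        · split_ifs at h1 <;> omega
    · intro x hx
      have h1 := hC hx
      have h2 := hmin x hx
      rw [Finset.mem_sdiff]
      rw [Finset.mem_insert, Finset.mem_sdiff] at h1
      rcases h1 with rfl | ⟨h1, h3⟩
      · refine ⟨hB'.1 hi, ?_⟩
        simp; omega
      · refine ⟨h1, ?_⟩
        simp only [Finset.mem_insert, Finset.mem_erase, not_or, not_and]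
        exact ⟨by omega, fun _ => h3⟩

/-- The `B`s of the sum. -/
def Nice (n r : ℕ) (U B : Finset ℕ) : Prop :=
  B ⊆ Finset.Icc 1 n ∧ B.card = r ∧ 1 ∉ B ∧ 2 ∈ B ∧
    ∀ k ∈ B, cnt B (k - 1) < cnt U (k - 1)

lemma nice_iff (hU : U ⊆ Finset.Icc 1 n) (hr : U.card = r) (hn : 2 ≤ n) (hr1 : 1 ≤ r)
    (B : Finset ℕ) :
    (B ∈ schubertBases n r U ∧ extAct (Finset.Icc 1 n) (schubertBases n r U) B = 1 ∧
      intAct (Finset.Icc 1 n) (schubertBases n r U) B = 0) ↔ Nice n r U B := by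
  constructor
  · rintro ⟨hB, he, hi⟩
    have hB' := (mem_bases hU hr B).1 hB
    rw [extAct_eq_one hU hr hn hr1 hB] at he
    rw [intAct_eq_zero hU hr hB he.1] at hi
    exact ⟨hB'.1, hB'.2.1, he.1, he.2, hi⟩
  · rintro ⟨h1, h2, h3, h4, h5⟩
    have hB : B ∈ schubertBases n r U := by
      rw [mem_bases hU hr]
      refine ⟨h1, h2, fun k => ?_⟩
      induction k with
      | zero => simp [cnt_zero]
      | succ k ih =>
        have hm := cnt_mono U (Nat.le_succ k)
        rw [cnt_succ B]
        split_ifs with hk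
        · have := h5 _ hk
          simp only [Nat.add_sub_cancel] at this
          simp only [Nat.succ_eq_add_one] at hm
          omega
        · simp only [Nat.succ_eq_add_one] at hm
          omega
    refine ⟨hB, (extAct_eq_one hU hr hn hr1 hB).2 ⟨h3, h4⟩, (intAct_eq_zero hU hr hB h3).2 h5⟩

lemma alpha_eq (hU : U ⊆ Finset.Icc 1 n) (hr : U.card = r) (hn : 2 ≤ n) (hr1 : 1 ≤ r)
    {B : Finset ℕ} (hB : Nice n r U B) :
    alphaStat (Finset.Icc 1 n) (schubertBases n r U) B =
      (B.filter fun k => 3 ≤ k ∧ k + 1 < 3 + (n - 2) ∧ k + 1 ∉ B).card := by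
  have hB0 := (nice_iff hU hr hn hr1 B).2 hB
  obtain ⟨hs, hc, h1, h2, h5⟩ := hB
  unfold alphaStat
  congr 1
  apply Finset.filter_congr
  intro k hk
  rw [hB0.2.1, hB0.2.2, nice_iff hU hr hn hr1]
  have hkI := Finset.mem_Icc.1 (hs hk)
  have hk1 : k ≠ 1 := by rintro rfl; exact h1 hk
  constructor
  · rintro ⟨g1, g2, g3, g4, g5⟩
    have hkB : k + 1 ∉ B := by
      intro hkB
      rw [Finset.insert_eq_of_mem (Finset.mem_erase.2 ⟨by omega, hkB⟩)] at g2
      have := Finset.card_erase_add_one hk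
      omega
    have := Finset.mem_Icc.1 (g1 (Finset.mem_insert_self _ _))
    refine ⟨?_, by omega, hkB⟩
    rw [Finset.mem_insert, Finset.mem_erase] at g4
    omega
  · rintro ⟨g1, g2, hkB⟩
    refine ⟨?_, ?_, ?_, ?_, ?_⟩
    · exact Finset.insert_subset (Finset.mem_Icc.2 ⟨by omega, by omega⟩)
        ((Finset.erase_subset _ _).trans hs)
    · rw [exch_card hk hkB]; exact hc
    · simp only [Finset.mem_insert, Finset.mem_erase, not_or, not_and]
      exact ⟨by omega, fun _ => h1⟩
    · simp only [Finset.mem_insert, Finset.mem_erase]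
      exact Or.inr ⟨by omega, h2⟩
    · intro j hj
      have hx := exch_cnt hk hkB hkI.1 (by omega) (j - 1)
      rw [Finset.mem_insert, Finset.mem_erase] at hj
      rcases hj with rfl | ⟨hjk, hj⟩
      · have a1 := h5 k hk
        have a2 := cnt_succ B (k - 1)
        have a3 := cnt_mono U (Nat.sub_le k 1)
        rw [show k - 1 + 1 = k by omega, if_pos hk] at a2
        simp only [Nat.add_sub_cancel] at hx ⊢
        split_ifs at hx <;> omega
      · have := h5 j hj
        split_ifs at hx <;> omega

end activity

/-! #### Words -/

/-- The word of `B` on positions `a, …, a + m - 1`. -/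
noncomputable def word (B : Finset ℕ) : ℕ → ℕ → List DStep
  | _, 0 => []
  | a, m + 1 => (if a ∈ B then DStep.north else DStep.east) :: word B (a + 1) m

/-- Number of factors `NE`. -/
def peaks : List DStep → ℕ
  | [] => 0
  | [_] => 0
  | s :: t :: w => (if s = DStep.north ∧ t = DStep.east then 1 else 0) + peaks (t :: w)

lemma peaks_word (B : Finset ℕ) : ∀ (m a : ℕ),
    peaks (word B a m) = (B.filter fun k => a ≤ k ∧ k + 1 < a + m ∧ k + 1 ∉ B).card
  | 0, a => by
    symm
    simp only [word, peaks, Finset.card_eq_zero, Finset.filter_eq_empty_iff]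
    intro k _; omega
  | 1, a => by
    symm
    simp only [word, peaks, Finset.card_eq_zero, Finset.filter_eq_empty_iff]
    intro k _; omega
  | m + 2, a => by
    have ih := peaks_word B (m + 1) (a + 1)
    simp only [word, peaks] at ih ⊢
    rw [ih]
    by_cases h : a ∈ B ∧ a + 1 ∉ B
    · rw [if_pos (by simp [h.1, h.2]), add_comm, ← Finset.card_insert_of_notMem (a := a) (by simp)]
      congr 1
      ext k
      simp only [Finset.mem_insert, Finset.mem_filter]
      constructor
      · rintro (rfl | ⟨h1, h2, h3, h4⟩)
        · exact ⟨h.1, le_rfl, by omega, h.2⟩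
        · exact ⟨h1, by omega, by omega, h4⟩
      · rintro ⟨h1, h2, h3, h4⟩
        by_cases hk : k = a
        · exact Or.inl hk
        · exact Or.inr ⟨h1, by omega, by omega, h4⟩
    · rw [if_neg (by simpa using h), zero_add]
      congr 1
      ext k
      simp only [Finset.mem_filter]
      constructor
      · rintro ⟨h1, h2, h3, h4⟩
        exact ⟨h1, by omega, by omega, h4⟩
      · rintro ⟨h1, h2, h3, h4⟩
        refine ⟨h1, ?_, by omega, h4⟩
        by_contra hk
        have : k = a := by omega
        subst this
        exact h ⟨h1, h4⟩

lemma word_inj {B B' : Finset ℕ} : ∀ (m a : ℕ), word B a m = word B' a m →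
    ∀ k, a ≤ k → k < a + m → (k ∈ B ↔ k ∈ B')
  | 0, a, _, k, h1, h2 => by omega
  | m + 1, a, h, k, h1, h2 => by
    simp only [word, List.cons.injEq] at h
    by_cases hk : k = a
    · subst hk
      have := h.1
      split_ifs at this <;> simp_all
    · exact word_inj m (a + 1) h.2 k (by omega) (by omega)

lemma word_congr {B B' : Finset ℕ} : ∀ (m a : ℕ),
    (∀ k, a ≤ k → k < a + m → (k ∈ B ↔ k ∈ B')) → word B a m = word B' a m
  | 0, a, _ => rfl
  | m + 1, a, h => by
    simp only [word]
    rw [word_congr m (a + 1) (fun k h1 h2 => h k (by omega) (by omega))]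
    simp only [h a le_rfl (by omega)]

lemma diag_notMem_word (B : Finset ℕ) : ∀ (m a : ℕ), DStep.diag ∉ word B a m
  | 0, a => by simp [word]
  | m + 1, a => by
    simp only [word, List.mem_cons, not_or]
    refine ⟨?_, diag_notMem_word B m (a + 1)⟩
    split_ifs <;> simp

lemma exists_word : ∀ (w : List DStep) (a : ℕ), DStep.diag ∉ w →
    ∃ S : Finset ℕ, (∀ k ∈ S, a ≤ k ∧ k < a + w.length) ∧ word S a w.length = w
  | [], a, _ => ⟨∅, by simp, rfl⟩
  | s :: w, a, h => by
    simp only [List.mem_cons, not_or] at h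
    obtain ⟨S, hS, hw⟩ := exists_word w (a + 1) h.2
    have haS : a ∉ S := fun hm => by have := hS a hm; omega
    cases s with
    | east =>
      refine ⟨S, fun k hk => ?_, ?_⟩
      · have := hS k hk
        simp only [List.length_cons]; omega
      · simp [word, haS, hw]
    | north =>
      refine ⟨insert a S, fun k hk => ?_, ?_⟩
      · simp only [List.length_cons]
        rcases Finset.mem_insert.1 hk with rfl | hk
        · omega
        · have := hS k hk; omega
      · simp only [List.length_cons, word, Finset.mem_insert, true_or, if_true]
        rw [word_congr (B' := S), hw]
        intro k h1 h2
        rw [Finset.mem_insert, or_iff_right (by omega)]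
    | diag => simp at h

/-! #### Good paths -/

/-- Recursive description of admissibility. -/
def Good (n r : ℕ) (U : Finset ℕ) : ℕ → ℕ → List DStep → Prop
  | x, y, [] => x + y = n ∧ y = r
  | x, y, DStep.east :: P => Good n r U (x + 1) y P
  | x, y, DStep.north :: P => y < cnt U (x + y) ∧ Good n r U x (y + 1) P
  | x, y, DStep.diag :: P => y < cnt U (x + y) ∧ Good n r U (x + 1) (y + 1) P

/-- Expand all diagonal steps. -/
def expand (P : List DStep) : List DStep := (P.map expandNE).flatten

lemma expand_nil : expand [] = [] := rfl
lemma expand_east (P : List DStep) : expand (DStep.east :: P) = DStep.east :: expand P := rfl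
lemma expand_north (P : List DStep) : expand (DStep.north :: P) = DStep.north :: expand P := rfl
lemma expand_diag (P : List DStep) :
    expand (DStep.diag :: P) = DStep.north :: DStep.east :: expand P := rfl

lemma diag_notMem_expand : ∀ P : List DStep, DStep.diag ∉ expand P
  | [] => by simp [expand_nil]
  | DStep.east :: P => by simp [expand_east, diag_notMem_expand P]
  | DStep.north :: P => by simp [expand_north, diag_notMem_expand P]
  | DStep.diag :: P => by simp [expand_diag, diag_notMem_expand P]

lemma good_expand (n r : ℕ) (U : Finset ℕ) : ∀ (P : List DStep) (x y : ℕ),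
    Good n r U x y (expand P) ↔ Good n r U x y P
  | [], x, y => Iff.rfl
  | DStep.east :: P, x, y => by simp only [expand_east, Good, good_expand n r U P]
  | DStep.north :: P, x, y => by simp only [expand_north, Good, good_expand n r U P]
  | DStep.diag :: P, x, y => by simp only [expand_diag, Good, good_expand n r U P]

lemma good_length (n r : ℕ) (U : Finset ℕ) : ∀ (w : List DStep) (x y : ℕ),
    DStep.diag ∉ w → Good n r U x y w → x + y + w.length = n
  | [], x, y, _, h => by simpa using h.1
  | DStep.east :: P, x, y, hd, h => by
    have := good_length n r U P (x + 1) y (by simp at hd; exact hd) h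
    simp; omega
  | DStep.north :: P, x, y, hd, h => by
    have := good_length n r U P x (y + 1) (by simp at hd; exact hd) h.2
    simp; omega
  | DStep.diag :: P, x, y, hd, h => by simp at hd

lemma good_word (n r : ℕ) (U B : Finset ℕ) : ∀ (m x y : ℕ), cnt B (x + y) = y →
    (Good n r U x y (word B (x + y + 1) m) ↔
      (x + y + m = n ∧ cnt B (x + y + m) = r ∧
        ∀ k ∈ B, x + y + 1 ≤ k → k < x + y + 1 + m → cnt B (k - 1) < cnt U (k - 1)))
  | 0, x, y, h => by
    simp only [word, Good, add_zero, h]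
    constructor
    · rintro ⟨h1, h2⟩
      exact ⟨h1, h2, fun k _ h3 h4 => by omega⟩
    · rintro ⟨h1, h2, _⟩
      exact ⟨h1, h2⟩
  | m + 1, x, y, h => by
    have hs := cnt_succ B (x + y)
    by_cases hB : x + y + 1 ∈ B
    · rw [if_pos hB, h] at hs
      have ih := good_word n r U B m x (y + 1) hs
      simp only [word, if_pos hB, Good]
      rw [← add_assoc] at ih
      rw [ih]
      constructor
      · rintro ⟨h1, h2, h3, h4⟩
        refine ⟨by omega, by rw [← h3]; congr 1; omega, fun k hk hk1 hk2 => ?_⟩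
        by_cases hkx : k = x + y + 1
        · subst hkx
          simpa [h] using h1
        · exact h4 k hk (by omega) (by omega)
      · rintro ⟨h1, h2, h3⟩
        refine ⟨?_, by omega, by rw [← h2]; congr 1; omega, fun k hk hk1 hk2 => ?_⟩
        · simpa [h] using h3 _ hB le_rfl (by omega)
        · exact h3 k hk (by omega) (by omega)
    · rw [if_neg hB, h, add_zero] at hs
      have e : x + 1 + y = x + y + 1 := by omega
      have ih := good_word n r U B m (x + 1) y (by rw [e, hs])
      simp only [word, if_neg hB, Good]
      rw [e] at ih
      rw [ih]
      constructor
      · rintro ⟨h2, h3, h4⟩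
        refine ⟨by omega, by rw [← h3]; congr 1; omega, fun k hk hk1 hk2 => ?_⟩
        by_cases hkx : k = x + y + 1
        · subst hkx
          exact absurd hk hB
        · exact h4 k hk (by omega) (by omega)
      · rintro ⟨h1, h2, h3⟩
        refine ⟨by omega, by rw [← h2]; congr 1; omega, fun k hk hk1 hk2 => ?_⟩
        exact h3 k hk (by omega) (by omega)

lemma pathPos_zero (s : ℕ × ℕ) (P : List DStep) : pathPos s P 0 = s := by
  simp [pathPos]

lemma pathPos_cons (s : ℕ × ℕ) (d : DStep) (P : List DStep) (k : ℕ) :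
    pathPos s (d :: P) (k + 1) = pathPos (s.1 + d.dx, s.2 + d.dy) P k := by
  simp [pathPos, add_assoc]

/-- Admissibility from an arbitrary start. -/
def AdmFrom (n r : ℕ) (U : Finset ℕ) (s : ℕ × ℕ) (P : List DStep) : Prop :=
  (pathPos s P P.length = (n - r, r) ∧ ∀ k ≤ P.length, belowPath U (pathPos s P k)) ∧
    ∀ (k : ℕ) (h : k < P.length),
      (P.get ⟨k, h⟩ = DStep.north →
        pathPos s P (k + 1) = (n - r, r) ∨
          ¬ uVertSeg U (pathPos s P k).1 (pathPos s P k).2) ∧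
      (P.get ⟨k, h⟩ = DStep.diag →
        belowPath U ((pathPos s P k).1, (pathPos s P k).2 + 1) ∧
          ¬ uVertSeg U (pathPos s P k).1 (pathPos s P k).2)

lemma admFrom_cons (n r : ℕ) (U : Finset ℕ) (s : ℕ × ℕ) (d : DStep) (P : List DStep) :
    AdmFrom n r U s (d :: P) ↔ belowPath U s ∧
      (d = DStep.north → (s.1 + d.dx, s.2 + d.dy) = (n - r, r) ∨ ¬ uVertSeg U s.1 s.2) ∧
      (d = DStep.diag → belowPath U (s.1, s.2 + 1) ∧ ¬ uVertSeg U s.1 s.2) ∧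
      AdmFrom n r U (s.1 + d.dx, s.2 + d.dy) P := by
  unfold AdmFrom
  constructor
  · rintro ⟨⟨h1, h2⟩, h3⟩
    have h30 := h3 0 (by simp)
    simp only [pathPos_zero, pathPos_cons, List.get_eq_getElem, List.getElem_cons_zero] at h30
    refine ⟨by simpa [pathPos_zero] using h2 0 (by simp), h30.1, h30.2, ⟨?_, ?_⟩, ?_⟩
    · rwa [List.length_cons, pathPos_cons] at h1
    · intro k hk
      have := h2 (k + 1) (by simpa using hk)
      rwa [pathPos_cons] at this
    · intro k hk
      have := h3 (k + 1) (by simpa using hk)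
      simpa only [pathPos_cons, List.get_eq_getElem, List.getElem_cons_succ] using this
  · rintro ⟨h1, h2, h3, ⟨h4, h5⟩, h6⟩
    refine ⟨⟨?_, ?_⟩, ?_⟩
    · rwa [List.length_cons, pathPos_cons]
    · rintro (_ | k) hk
      · simpa [pathPos_zero] using h1
      · rw [pathPos_cons]
        exact h5 k (by simpa using hk)
    · rintro (_ | k) hk
      · simp only [pathPos_zero, pathPos_cons, List.get_eq_getElem, List.getElem_cons_zero]
        exact ⟨h2, h3⟩
      · have := h6 k (by simpa using hk)
        simpa only [pathPos_cons, List.get_eq_getElem, List.getElem_cons_succ] using this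

lemma step_iff (U : Finset ℕ) (x y : ℕ) (h : y ≤ cnt U (x + y)) :
    (belowPath U (x, y + 1) ∧ ¬ uVertSeg U x y) ↔ y < cnt U (x + y) := by
  unfold belowPath uVertSeg
  change (y + 1 ≤ cnt U (x + y + 1) ∧ ¬ (x + y + 1 ∈ U ∧ cnt U (x + y + 1) = y + 1)) ↔ _
  rw [cnt_succ]
  by_cases hU : x + y + 1 ∈ U <;> simp [hU] <;> omega

lemma adm_iff_good {n r : ℕ} {U : Finset ℕ} (hrn : r ≤ n) (hn1 : 1 ≤ n)
    (hlast : cnt U (n - 1) = r) :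
    ∀ (P : List DStep) (x y : ℕ), y ≤ cnt U (x + y) →
      (AdmFrom n r U (x, y) P ↔ Good n r U x y P)
  | [], x, y, h => by
    simp only [AdmFrom, Good, pathPos]
    simp
    constructor
    · rintro ⟨⟨h1, h2⟩, _⟩
      omega
    · rintro ⟨h1, h2⟩
      exact ⟨by omega, h⟩
  | DStep.east :: P, x, y, h => by
    have hm := cnt_mono U (show x + y ≤ x + 1 + y by omega)
    rw [admFrom_cons]
    simp only [DStep.dx, DStep.dy, add_zero, Good]
    rw [adm_iff_good hrn hn1 hlast P (x + 1) y (by omega)]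
    simp [belowPath]
    intro _
    exact h
  | DStep.north :: P, x, y, h => by
    have hm := cnt_mono U (show x + y ≤ x + (y + 1) by omega)
    have hs := step_iff U x y h
    rw [admFrom_cons]
    simp only [DStep.dx, DStep.dy, add_zero, Good]
    constructor
    · rintro ⟨h1, h2, _, h4⟩
      have hb : belowPath U (x, y + 1) := by
        have := h4.1.2 0 (by simp)
        rwa [pathPos_zero] at this
      have hlt : y < cnt U (x + y) := by
        rcases h2 trivial with h2 | h2
        · simp only [Prod.mk.injEq] at h2
          rw [show x + y = n - 1 by omega, hlast]
          omega
        · exact hs.1 ⟨hb, h2⟩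
      exact ⟨hlt, (adm_iff_good hrn hn1 hlast P x (y + 1) (by omega)).1 h4⟩
    · rintro ⟨h1, h2⟩
      refine ⟨h, fun _ => Or.inr (hs.2 h1).2, by simp, ?_⟩
      exact (adm_iff_good hrn hn1 hlast P x (y + 1) (by omega)).2 h2
  | DStep.diag :: P, x, y, h => by
    have hm := cnt_mono U (show x + y ≤ x + 1 + (y + 1) by omega)
    have hs := step_iff U x y h
    rw [admFrom_cons]
    simp only [DStep.dx, DStep.dy, Good]
    constructor
    · rintro ⟨h1, _, h3, h4⟩
      have hlt := hs.1 (h3 trivial)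
      exact ⟨hlt, (adm_iff_good hrn hn1 hlast P (x + 1) (y + 1) (by omega)).1 h4⟩
    · rintro ⟨h1, h2⟩
      refine ⟨h, by simp, fun _ => hs.2 h1, ?_⟩
      exact (adm_iff_good hrn hn1 hlast P (x + 1) (y + 1) (by omega)).2 h2

/-! #### Fibres of the expansion -/

lemma diagCount_cons (s : DStep) (P : List DStep) :
    diagCount (s :: P) = diagCount P + if s = DStep.diag then 1 else 0 := by
  unfold diagCount
  rw [List.filter_cons]
  cases s <;> simp

lemma cons_inj (s : DStep) : Function.Injective (fun P : List DStep => s :: P) :=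
  fun _ _ h => (List.cons.inj h).2

lemma fibre : ∀ (w : List DStep), DStep.diag ∉ w → ∀ i : ℕ,
    ∃ F : Finset (List DStep), F.card = Nat.choose (peaks w) i ∧
      ∀ P, P ∈ F ↔ expand P = w ∧ diagCount P = i
  | [], _, i => by
    have key : ∀ P, expand P = [] ↔ P = [] := by
      rintro (_ | ⟨_ | _ | _, P⟩) <;> simp [expand_nil, expand_east, expand_north, expand_diag]
    rcases i with _ | i
    · refine ⟨{[]}, by simp [peaks], fun P => ?_⟩
      rw [key]
      simp only [Finset.mem_singleton]
      exact ⟨fun h => ⟨h, by subst h; rfl⟩, fun h => h.1⟩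
    · refine ⟨∅, by simp [peaks], fun P => ?_⟩
      rw [key]
      simp only [Finset.notMem_empty, false_iff]
      rintro ⟨rfl, h⟩
      simp [diagCount] at h
  | DStep.diag :: w, h, i => by simp at h
  | DStep.east :: w, h, i => by
    simp only [List.mem_cons, not_or] at h
    obtain ⟨F, hF, hm⟩ := fibre w h.2 i
    refine ⟨F.image (DStep.east :: ·), ?_, ?_⟩
    · rw [Finset.card_image_of_injective _ (cons_inj _), hF]
      cases w <;> simp [peaks]
    · rintro (_ | ⟨_ | _ | _, P⟩) <;>
        simp [expand_nil, expand_east, expand_north, expand_diag, hm, diagCount_cons]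
  | [DStep.north], h, i => by
    obtain ⟨F, hF, hm⟩ := fibre [] (by simp) i
    refine ⟨F.image (DStep.north :: ·), ?_, ?_⟩
    · rw [Finset.card_image_of_injective _ (cons_inj _), hF]
      simp [peaks]
    · rintro (_ | ⟨_ | _ | _, P⟩) <;>
        simp [expand_nil, expand_east, expand_north, expand_diag, hm, diagCount_cons]
  | DStep.north :: DStep.diag :: w, h, i => by simp at h
  | DStep.north :: DStep.north :: w, h, i => by
    obtain ⟨F, hF, hm⟩ := fibre (DStep.north :: w) (by simpa using h) i
    refine ⟨F.image (DStep.north :: ·), ?_, ?_⟩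
    · rw [Finset.card_image_of_injective _ (cons_inj _), hF]
      simp [peaks]
    · rintro (_ | ⟨_ | _ | _, P⟩) <;>
        simp [expand_nil, expand_east, expand_north, expand_diag, hm, diagCount_cons]
  | DStep.north :: DStep.east :: w, h, i => by
    have hw : DStep.diag ∉ w := by simpa using h
    have hp : peaks (DStep.east :: w) = peaks w := by cases w <;> simp [peaks]
    obtain ⟨F, hF, hm⟩ := fibre (DStep.east :: w) (by simpa using h) i
    rcases i with _ | i
    · refine ⟨F.image (DStep.north :: ·), ?_, ?_⟩
      · rw [Finset.card_image_of_injective _ (cons_inj _), hF]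
        simp
      · rintro (_ | ⟨_ | _ | _, P⟩) <;>
          simp [expand_nil, expand_east, expand_north, expand_diag, hm, diagCount_cons]
    · obtain ⟨F', hF', hm'⟩ := fibre w hw i
      refine ⟨F.image (DStep.north :: ·) ∪ F'.image (DStep.diag :: ·), ?_, ?_⟩
      · rw [Finset.card_union_of_disjoint,
          Finset.card_image_of_injective _ (cons_inj _),
          Finset.card_image_of_injective _ (cons_inj _), hF, hF']
        · simp only [peaks, hp, and_self, if_true]
          rw [add_comm 1 (peaks w), Nat.choose_succ_succ', add_comm]
        · rw [Finset.disjoint_left]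
          intro P hP hP'
          simp only [Finset.mem_image] at hP hP'
          obtain ⟨_, _, rfl⟩ := hP
          obtain ⟨_, _, hh⟩ := hP'
          simp at hh
      · rintro (_ | ⟨_ | _ | _, P⟩) <;>
          simp [expand_nil, expand_east, expand_north, expand_diag, hm, hm', diagCount_cons]

lemma cnt_two {B : Finset ℕ} (h1 : 1 ∉ B) (h2 : 2 ∈ B) : cnt B 2 = 1 := by
  rw [cnt_succ, cnt_succ, cnt_zero]; simp [h1, h2]

lemma nice_good {n r : ℕ} {U B : Finset ℕ} (hn : 2 ≤ n) (h1U : 1 ∈ U)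
    (hB : B ⊆ Finset.Icc 1 n) (h1 : 1 ∉ B) (h2 : 2 ∈ B) :
    Good n r U 1 1 (word B 3 (n - 2)) ↔ Nice n r U B := by
  have := good_word n r U B (n - 2) 1 1 (cnt_two h1 h2)
  rw [this]
  have e : 1 + 1 + (n - 2) = n := by omega
  rw [e, cnt_full hB le_rfl]
  have hU1 : cnt U 1 = 1 := by rw [cnt_succ, cnt_zero]; simp [h1U]
  have hB1 : cnt B 1 = 0 := by rw [cnt_succ, cnt_zero]; simp [h1]
  constructor
  · rintro ⟨_, g2, g3⟩
    refine ⟨hB, g2, h1, h2, fun k hk => ?_⟩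
    have hkI := Finset.mem_Icc.1 (hB hk)
    have hk1 : k ≠ 1 := by rintro rfl; exact h1 hk
    by_cases hk2 : k = 2
    · subst hk2
      simp [hU1, hB1]
    · exact g3 k hk (by omega) (by omega)
  · rintro ⟨_, g2, _, _, g3⟩
    exact ⟨rfl, g2, fun k hk _ _ => g3 k hk⟩

/-- For a loopless and coloopless Schubert matroid `SM(U)` on `[n]` of
rank `r` and every `i ≥ 0`, the number of admissible Delannoy paths associated to `SM(U)`
with exactly `i` diagonal steps equals the sum, over the bases `B` with `e(B) = 1` and
`i(B) = 0`, of the binomial coefficient `C(α(B), i)`. -/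
theorem statement1 (n r : ℕ) (U : Finset ℕ) (hUsub : U ⊆ Finset.Icc 1 n)
    (hUcard : U.card = r)
    (hloopless : ∀ e ∈ Finset.Icc 1 n, ∃ B ∈ schubertBases n r U, e ∈ B)
    (hcoloopless : ∀ e ∈ Finset.Icc 1 n, ∃ B ∈ schubertBases n r U, e ∉ B)
    (i : ℕ) :
    {P : List DStep | IsAdmissible n r U P ∧ diagCount P = i}.ncard
      = ∑ B ∈ (schubertBases n r U).filter (fun B =>
            extAct (Finset.Icc 1 n) (schubertBases n r U) B = 1 ∧
            intAct (Finset.Icc 1 n) (schubertBases n r U) B = 0),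
          Nat.choose (alphaStat (Finset.Icc 1 n) (schubertBases n r U) B) i := by
  rcases Nat.eq_zero_or_pos n with rfl | hn0
  · have hU0 : U = ∅ := by simpa using hUsub
    subst hU0
    have hr0 : r = 0 := by simpa using hUcard.symm
    subst hr0
    have hset : {P : List DStep | IsAdmissible 0 0 ∅ P ∧ diagCount P = i} = ∅ := by
      ext P
      simp only [Set.mem_setOf_eq, Set.mem_empty_iff_false, iff_false]
      rintro ⟨⟨⟨h, _⟩, _⟩, _⟩
      simp [pathPos] at h
    rw [hset, Set.ncard_empty, Finset.filter_false_of_mem, Finset.sum_empty]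
    rintro B - ⟨h, _⟩
    simp [extAct] at h
  · have h1U : 1 ∈ U := by
      obtain ⟨B, hB, h1⟩ := hloopless 1 (Finset.mem_Icc.2 ⟨le_rfl, hn0⟩)
      have := ((mem_bases hUsub hUcard B).1 hB).2.2 1
      rw [cnt_succ, cnt_succ, cnt_zero, cnt_zero] at this
      by_contra h
      simp [h, h1] at this
    have hlast : cnt U (n - 1) = r := by
      obtain ⟨B, hB, h1⟩ := hcoloopless n (Finset.mem_Icc.2 ⟨hn0, le_rfl⟩)
      have hB' := (mem_bases hUsub hUcard B).1 hB
      have a1 := hB'.2.2 (n - 1)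
      have a2 := cnt_succ B (n - 1)
      rw [show n - 1 + 1 = n by omega, if_neg h1, cnt_full hB'.1 le_rfl, hB'.2.1] at a2
      have a3 := cnt_mono U (Nat.sub_le n 1)
      rw [cnt_full hUsub le_rfl, hUcard] at a3
      omega
    have hr1 : 1 ≤ r := by
      rw [← hUcard]; exact Finset.card_pos.2 ⟨1, h1U⟩
    have hn : 2 ≤ n := by
      by_contra h
      rw [show n - 1 = 0 by omega, cnt_zero] at hlast
      omega
    have hrn : r ≤ n := by
      have := Finset.card_le_card hUsub
      simpa [hUcard] using this
    have hU2 : 1 ≤ cnt U (1 + 1) := by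
      rw [cnt_succ, cnt_succ, cnt_zero]; simp [h1U]
    choose F hFcard hFmem using fun B : Finset ℕ =>
      fibre (word B 3 (n - 2)) (diag_notMem_word B _ _) i
    have hmemB : ∀ B, B ∈ (schubertBases n r U).filter (fun B =>
            extAct (Finset.Icc 1 n) (schubertBases n r U) B = 1 ∧
            intAct (Finset.Icc 1 n) (schubertBases n r U) B = 0) ↔ Nice n r U B := by
      intro B
      rw [Finset.mem_filter, nice_iff hUsub hUcard hn hr1]
    have hset : {P : List DStep | IsAdmissible n r U P ∧ diagCount P = i} =
        ↑(((schubertBases n r U).filter (fun B =>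
            extAct (Finset.Icc 1 n) (schubertBases n r U) B = 1 ∧
            intAct (Finset.Icc 1 n) (schubertBases n r U) B = 0)).biUnion F) := by
      ext P
      simp only [Set.mem_setOf_eq, Finset.mem_coe, Finset.mem_biUnion, hmemB, hFmem]
      have hag : IsAdmissible n r U P ↔ Good n r U 1 1 P :=
        adm_iff_good hrn hn0 hlast P 1 1 hU2
      rw [hag, ← good_expand]
      constructor
      · rintro ⟨hg, hd⟩
        have hlen := good_length n r U _ 1 1 (diag_notMem_expand P) hg
        obtain ⟨S, hS, hw⟩ := exists_word (expand P) 3 (diag_notMem_expand P)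
        have hl : (expand P).length = n - 2 := by omega
        rw [hl] at hw hS
        have hw2 : word (insert 2 S) 3 (n - 2) = expand P := by
          rw [← hw]
          apply word_congr
          intro k h1 _
          rw [Finset.mem_insert, or_iff_right (by omega)]
        refine ⟨insert 2 S, ?_, hw2.symm, hd⟩
        rw [← nice_good hn h1U, hw2]
        · exact hg
        · intro k hk
          rw [Finset.mem_Icc]
          rcases Finset.mem_insert.1 hk with rfl | hk
          · omega
          · have := hS k hk; omega
        · intro h
          rcases Finset.mem_insert.1 h with h | h
          · omega
          · have := hS 1 h; omega
        · exact Finset.mem_insert_self _ _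
      · rintro ⟨B, hB, hw, hd⟩
        rw [hw, nice_good hn h1U hB.1 hB.2.2.1 hB.2.2.2.1]
        exact ⟨hB, hd⟩
    rw [hset, Set.ncard_coe_finset, Finset.card_biUnion]
    · refine Finset.sum_congr rfl fun B hB => ?_
      rw [hFcard, peaks_word, alpha_eq hUsub hUcard hn hr1 ((hmemB B).1 hB)]
    · intro B hB B' hB' hne
      have hN := (hmemB B).1 hB
      have hN' := (hmemB B').1 hB'
      refine Finset.disjoint_left.2 ?_
      intro P hP hP'
      rw [hFmem] at hP hP'
      have hinj := word_inj (n - 2) 3 (hP.1.symm.trans hP'.1)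
      apply hne
      ext k
      by_cases hk : 3 ≤ k ∧ k < 3 + (n - 2)
      · exact hinj k hk.1 hk.2
      · have a1 : k ∈ B → 1 ≤ k ∧ k ≤ n := fun h => Finset.mem_Icc.1 (hN.1 h)
        have a2 : k ∈ B' → 1 ≤ k ∧ k ≤ n := fun h => Finset.mem_Icc.1 (hN'.1 h)
        by_cases h1 : k = 1
        · subst h1
          simp [hN.2.2.1, hN'.2.2.1]
        · by_cases h2 : k = 2
          · subst h2
            simp [hN.2.2.2.1, hN'.2.2.2.1]
          · constructor
            · intro h; have := a1 h; omega
            · intro h; have := a2 h; omega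

end GPoly
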